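/- arXiv:2004.00241 — 7 statements merged into one kernel-verified Lean document; each statement's English description precedes it below -/
import Mathlib

section
/- Let λ > 0, let t, d, n be positive natural numbers, let Zᵃ, Y ∈ ℝ^{t×d}, W, H ∈ ℝ^{t×n}, and Θ⋆ ∈ ℝ^{d×n}. Set Z̄ = Zᵃ + Y, X̄ = Zᵃ·Θ⋆ + W + H, V̄ = Z̄ᵀZ̄ + λ·I (which is invertible), and Θ̂ = V̄⁻¹ Z̄ᵀ X̄. Then Θ̂ − Θ⋆ = V̄⁻¹ Z̄ᵀ (W + H) − V̄⁻¹ (λ·I + Z̄ᵀY) Θ⋆. -/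
open Matrix

/-- Algebraic identity for the regularized least-squares estimate
computed from poisoned data: with `Z̄ = Zᵃ + Y`, `X̄ = Zᵃ·Θ⋆ + W + H`,
`V̄ = Z̄ᵀZ̄ + λI` (which is invertible), and `Θ̂ = V̄⁻¹ Z̄ᵀ X̄`, one has
`Θ̂ − Θ⋆ = V̄⁻¹ Z̄ᵀ (W + H) − V̄⁻¹ (λI + Z̄ᵀY) Θ⋆`. -/
theorem stmt_0 {t d n : ℕ} (ht : 0 < t) (hd : 0 < d) (hn : 0 < n)
    (lam : ℝ) (hlam : 0 < lam)
    (Za Y : Matrix (Fin t) (Fin d) ℝ) (W H : Matrix (Fin t) (Fin n) ℝ)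
    (Θs : Matrix (Fin d) (Fin n) ℝ)
    (Zb : Matrix (Fin t) (Fin d) ℝ) (hZb : Zb = Za + Y)
    (Xb : Matrix (Fin t) (Fin n) ℝ) (hXb : Xb = Za * Θs + W + H)
    (V : Matrix (Fin d) (Fin d) ℝ)
    (hV : V = Zbᵀ * Zb + lam • (1 : Matrix (Fin d) (Fin d) ℝ))
    (Θh : Matrix (Fin d) (Fin n) ℝ) (hΘh : Θh = V⁻¹ * Zbᵀ * Xb) :
    IsUnit V.det ∧
      Θh - Θs =
        V⁻¹ * Zbᵀ * (W + H) -
          V⁻¹ * (lam • (1 : Matrix (Fin d) (Fin d) ℝ) + Zbᵀ * Y) * Θs := by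
  have hdet : IsUnit V.det := by
    have hpos : V.PosDef := by
      rw [hV, ← conjTranspose_eq_transpose_of_trivial]
      exact PosDef.posSemidef_add (posSemidef_conjTranspose_mul_self Zb) (PosDef.one.smul hlam)
    exact hpos.det_pos.ne'.isUnit
  refine ⟨hdet, ?_⟩
  have hΘs : Θs = V⁻¹ * (V * Θs) := (nonsing_inv_mul_cancel_left V Θs hdet).symm
  have hZa : Za = Zb - Y := by rw [hZb, add_sub_cancel_right]
  have key : Zbᵀ * Xb - V * Θs =
      Zbᵀ * (W + H) - (lam • (1 : Matrix (Fin d) (Fin d) ℝ) + Zbᵀ * Y) * Θs := by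
    rw [hXb, hV, hZa]
    simp only [Matrix.mul_add, Matrix.add_mul, Matrix.sub_mul, Matrix.mul_sub, Matrix.mul_assoc]
    abel
  calc Θh - Θs = V⁻¹ * (Zbᵀ * Xb - V * Θs) := by
        rw [Matrix.mul_sub, ← hΘs, hΘh, Matrix.mul_assoc]
    _ = _ := by rw [key, Matrix.mul_sub, Matrix.mul_assoc, Matrix.mul_assoc]
end

section
/- Let λ > 0, let t, d, n be positive natural numbers, let Zᵃ, Y ∈ ℝ^{t×d}, W, H ∈ ℝ^{t×n}, and Θ⋆ ∈ ℝ^{d×n}. Set Z̄ = Zᵃ + Y, X̄ = Zᵃ·Θ⋆ + W + H, V̄ = Z̄ᵀZ̄ + λ·I, and Θ̂ = V̄⁻¹ Z̄ᵀ X̄. Then √(Tr((Θ̂ − Θ⋆)ᵀ V̄ (Θ̂ − Θ⋆))) ≤ √(Tr((Z̄ᵀW)ᵀ V̄⁻¹ (Z̄ᵀW))) + λ^{-1/2}·‖Z̄ᵀH‖_F + (√λ + λ^{-1/2}·‖Z̄ᵀY‖_F)·‖Θ⋆‖_F, where ‖·‖_F denotes the Frobenius norm. -/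
open Matrix

/-- Frobenius norm of a real matrix: `‖A‖_F = √(Tr(AᵀA))`. -/
noncomputable def frobNorm {a b : ℕ} (A : Matrix (Fin a) (Fin b) ℝ) : ℝ :=
  Real.sqrt (Matrix.trace (Aᵀ * A))

section Frobenius

open scoped Matrix.Norms.Frobenius

theorem frobNorm_eq_norm {a b : ℕ} (A : Matrix (Fin a) (Fin b) ℝ) : frobNorm A = ‖A‖ := by
  rw [frobNorm, Matrix.frobenius_norm_def, Real.sqrt_eq_rpow, Finset.sum_comm]
  simp [Matrix.trace, Matrix.mul_apply, pow_two]

theorem frobNorm_add_le {a b : ℕ} (A B : Matrix (Fin a) (Fin b) ℝ) :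
    frobNorm (A + B) ≤ frobNorm A + frobNorm B := by
  simpa only [frobNorm_eq_norm] using norm_add_le A B

theorem frobNorm_sub_le {a b : ℕ} (A B : Matrix (Fin a) (Fin b) ℝ) :
    frobNorm (A - B) ≤ frobNorm A + frobNorm B := by
  simpa only [frobNorm_eq_norm] using norm_sub_le A B

theorem frobNorm_mul_le {a b c : ℕ} (A : Matrix (Fin a) (Fin b) ℝ)
    (B : Matrix (Fin b) (Fin c) ℝ) : frobNorm (A * B) ≤ frobNorm A * frobNorm B := by
  simpa only [frobNorm_eq_norm] using Matrix.frobenius_norm_mul A B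

theorem frobNorm_smul {a b : ℕ} (r : ℝ) (A : Matrix (Fin a) (Fin b) ℝ) :
    frobNorm (r • A) = |r| * frobNorm A := by
  simpa only [frobNorm_eq_norm, Real.norm_eq_abs] using norm_smul r A

end Frobenius

theorem trace_transpose_mul_self_nonneg {a b : ℕ} (A : Matrix (Fin a) (Fin b) ℝ) :
    0 ≤ Matrix.trace (Aᵀ * A) := by
  simpa using (Matrix.posSemidef_conjTranspose_mul_self A).trace_nonneg

theorem posDef_transpose_mul_self_add_smul_one {a b : ℕ} (Z : Matrix (Fin a) (Fin b) ℝ)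
    {lam : ℝ} (hlam : 0 < lam) :
    (Zᵀ * Z + lam • (1 : Matrix (Fin b) (Fin b) ℝ)).PosDef := by
  have h := Matrix.posSemidef_conjTranspose_mul_self Z
  rw [Matrix.conjTranspose_eq_transpose_of_trivial] at h
  exact Matrix.PosDef.posSemidef_add h (Matrix.PosDef.one.smul hlam)

/-- The trace form of `V⁻¹ ⪯ λ⁻¹ I` for `V = ZᵀZ + λI`. -/
theorem mul_trace_inv_le_trace {a b c : ℕ} (Z : Matrix (Fin a) (Fin b) ℝ)
    {lam : ℝ} (hlam : 0 < lam) {V : Matrix (Fin b) (Fin b) ℝ}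
    (hV : V = Zᵀ * Z + lam • (1 : Matrix (Fin b) (Fin b) ℝ)) (S : Matrix (Fin b) (Fin c) ℝ) :
    lam * Matrix.trace (Sᵀ * V⁻¹ * S) ≤ Matrix.trace (Sᵀ * S) := by
  have hdet : IsUnit V.det := by
    rw [hV]
    exact (posDef_transpose_mul_self_add_smul_one Z hlam).det_pos.ne'.isUnit
  obtain ⟨T, hT⟩ : ∃ T, T = V⁻¹ * S := ⟨_, rfl⟩
  have hS : S = Zᵀ * (Z * T) + lam • T := by
    have : V * T = S := by rw [hT, Matrix.mul_nonsing_inv_cancel_left _ _ hdet]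
    rw [← this, hV, Matrix.add_mul, Matrix.smul_mul, Matrix.one_mul, Matrix.mul_assoc]
  have key : Sᵀ * S - lam • (Sᵀ * T) =
      (Zᵀ * (Z * T))ᵀ * (Zᵀ * (Z * T)) + lam • ((Z * T)ᵀ * (Z * T)) := by
    have h1 : S - lam • T = Zᵀ * (Z * T) := by rw [hS, add_sub_cancel_right]
    have h2 : Sᵀ * S - lam • (Sᵀ * T) = Sᵀ * (S - lam • T) := by
      rw [Matrix.mul_sub, Matrix.mul_smul]
    rw [h2, h1, hS, Matrix.transpose_add, Matrix.add_mul, Matrix.transpose_smul,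
      Matrix.smul_mul, Matrix.transpose_mul Z T, Matrix.mul_assoc Tᵀ]
  have htr := congrArg Matrix.trace key
  rw [Matrix.trace_sub, Matrix.trace_add, Matrix.trace_smul, Matrix.trace_smul, smul_eq_mul,
    smul_eq_mul] at htr
  have h1 := trace_transpose_mul_self_nonneg (Zᵀ * (Z * T))
  have h2 := mul_nonneg hlam.le (trace_transpose_mul_self_nonneg (Z * T))
  rw [Matrix.mul_assoc, ← hT]
  linarith

/-- Deterministic decomposition underlying the confidence set under a
database attack: with `Z̄ = Zᵃ + Y`, `X̄ = Zᵃ·Θ⋆ + W + H`, `V̄ = Z̄ᵀZ̄ + λI`, and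
`Θ̂ = V̄⁻¹ Z̄ᵀ X̄`, one has
`√(Tr((Θ̂−Θ⋆)ᵀ V̄ (Θ̂−Θ⋆))) ≤ √(Tr((Z̄ᵀW)ᵀ V̄⁻¹ (Z̄ᵀW))) + λ^{-1/2}‖Z̄ᵀH‖_F
  + (√λ + λ^{-1/2}‖Z̄ᵀY‖_F)‖Θ⋆‖_F`. -/
theorem stmt_1 {t d n : ℕ} (ht : 0 < t) (hd : 0 < d) (hn : 0 < n)
    (lam : ℝ) (hlam : 0 < lam)
    (Za Y : Matrix (Fin t) (Fin d) ℝ) (W H : Matrix (Fin t) (Fin n) ℝ)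
    (Θs : Matrix (Fin d) (Fin n) ℝ)
    (Zb : Matrix (Fin t) (Fin d) ℝ) (hZb : Zb = Za + Y)
    (Xb : Matrix (Fin t) (Fin n) ℝ) (hXb : Xb = Za * Θs + W + H)
    (V : Matrix (Fin d) (Fin d) ℝ)
    (hV : V = Zbᵀ * Zb + lam • (1 : Matrix (Fin d) (Fin d) ℝ))
    (Θh : Matrix (Fin d) (Fin n) ℝ) (hΘh : Θh = V⁻¹ * Zbᵀ * Xb) :
    Real.sqrt (Matrix.trace ((Θh - Θs)ᵀ * V * (Θh - Θs))) ≤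
      Real.sqrt (Matrix.trace ((Zbᵀ * W)ᵀ * V⁻¹ * (Zbᵀ * W))) +
        (1 / Real.sqrt lam) * frobNorm (Zbᵀ * H) +
        (Real.sqrt lam + (1 / Real.sqrt lam) * frobNorm (Zbᵀ * Y)) * frobNorm Θs := by
  have hpos : V.PosDef := hV ▸ posDef_transpose_mul_self_add_smul_one Zb hlam
  have hdet : IsUnit V.det := hpos.det_pos.ne'.isUnit
  obtain ⟨B, hB⟩ : ∃ B : Matrix (Fin d) (Fin d) ℝ, V⁻¹ = Bᵀ * B := by
    open scoped MatrixOrder in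
    obtain ⟨B, hB⟩ := CStarAlgebra.nonneg_iff_eq_star_mul_self.mp hpos.inv.posSemidef.nonneg
    exact ⟨B, by rw [hB, Matrix.star_eq_conjTranspose, conjTranspose_eq_transpose_of_trivial]⟩
  have hnorm (S : Matrix (Fin d) (Fin n) ℝ) :
      Real.sqrt (Matrix.trace (Sᵀ * V⁻¹ * S)) = frobNorm (B * S) := by
    rw [frobNorm, hB, Matrix.transpose_mul]
    simp only [Matrix.mul_assoc]
  have hs : 0 < Real.sqrt lam := Real.sqrt_pos.mpr hlam
  have hbound (S : Matrix (Fin d) (Fin n) ℝ) :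
      frobNorm (B * S) ≤ 1 / Real.sqrt lam * frobNorm S := by
    rw [← hnorm, one_div_mul_eq_div, le_div_iff₀ hs, mul_comm, ← Real.sqrt_mul hlam.le]
    exact Real.sqrt_le_sqrt (mul_trace_inv_le_trace Zb hlam hV S)
  have hVt : Vᵀ = V := by
    rw [← conjTranspose_eq_transpose_of_trivial, hpos.isHermitian.eq]
  have hVE : V * (Θh - Θs) = Zbᵀ * W + Zbᵀ * H - Zbᵀ * Y * Θs - lam • Θs := by
    have hZa : Za = Zb - Y := by rw [hZb, add_sub_cancel_right]
    rw [Matrix.mul_sub, hΘh, Matrix.mul_assoc V⁻¹, Matrix.mul_nonsing_inv_cancel_left _ _ hdet,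
      hV, hXb, hZa]
    simp only [Matrix.mul_add, Matrix.add_mul, Matrix.sub_mul, Matrix.mul_sub, Matrix.smul_mul,
      Matrix.one_mul, Matrix.mul_assoc]
    abel
  have hE : Matrix.trace ((Θh - Θs)ᵀ * V * (Θh - Θs)) =
      Matrix.trace ((V * (Θh - Θs))ᵀ * V⁻¹ * (V * (Θh - Θs))) := by
    rw [Matrix.transpose_mul, hVt, Matrix.mul_nonsing_inv_cancel_right _ _ hdet, Matrix.mul_assoc]
  rw [hE, hnorm, hnorm, hVE, Matrix.mul_sub, Matrix.mul_sub, Matrix.mul_add]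
  have hH := hbound (Zbᵀ * H)
  have hY : frobNorm (B * (Zbᵀ * Y * Θs)) ≤
      1 / Real.sqrt lam * frobNorm (Zbᵀ * Y) * frobNorm Θs := by
    rw [mul_assoc]
    exact (hbound _).trans
      (mul_le_mul_of_nonneg_left (frobNorm_mul_le _ _) (one_div_pos.mpr hs).le)
  have hΘ : frobNorm (B * (lam • Θs)) ≤ Real.sqrt lam * frobNorm Θs := by
    have h := hbound (lam • Θs)
    rwa [frobNorm_smul, abs_of_pos hlam, ← mul_assoc, one_div_mul_eq_div,
      Real.div_sqrt] at h
  have h1 := frobNorm_sub_le (B * (Zbᵀ * W) + B * (Zbᵀ * H) - B * (Zbᵀ * Y * Θs)) (B * (lam • Θs))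
  have h2 := frobNorm_sub_le (B * (Zbᵀ * W) + B * (Zbᵀ * H)) (B * (Zbᵀ * Y * Θs))
  have h3 := frobNorm_add_le (B * (Zbᵀ * W)) (B * (Zbᵀ * H))
  linarith
end

section
/- Let d ≥ 1 be a natural number, λ > 0, t ≥ 1 a natural number, and let z̄₀,…,z̄_{t−1} ∈ ℝ^d. For each s, set V̄_s = λ·I + Σ_{k<s} z̄_k z̄_kᵀ (a positive definite matrix). Then Σ_{s=0}^{t−1} min( z̄_sᵀ V̄_s⁻¹ z̄_s , 1 ) ≤ 2·log( det(V̄_t) / det(λI) ). -/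
open Matrix

theorem Real.min_one_le_two_mul_log_one_add {x : ℝ} (hx : 0 ≤ x) :
    min x 1 ≤ 2 * Real.log (1 + x) := by
  have hlog := Real.le_log_one_add_of_nonneg hx
  have hfrac : min x 1 / 2 ≤ 2 * x / (x + 2) := by
    rw [div_le_div_iff₀ two_pos (by linarith)]
    rcases le_total x 1 with h | h
    · rw [min_eq_left h]; nlinarith
    · rw [min_eq_right h]; linarith
  linarith

/-- The **matrix determinant lemma** for a rank-one update written with `vecMulVec`. -/
theorem Matrix.det_add_vecMulVec {n R : Type*} [Fintype n] [DecidableEq n] [CommRing R]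
    {A : Matrix n n R} (hA : IsUnit A.det) (u v : n → R) :
    (A + vecMulVec u v).det = A.det * (1 + v ⬝ᵥ (A⁻¹ *ᵥ u)) := by
  rw [vecMulVec_eq Unit, det_add_replicateCol_mul_replicateRow hA, det_unique (n := Unit),
    Matrix.mul_assoc, ← replicateCol_mulVec, add_apply, one_apply_eq,
    replicateRow_mul_replicateCol_apply]

/-- elliptical potential lemma, Lemma 4 of the paper. With
`V̄_s = λI + Σ_{k<s} z̄_k z̄_kᵀ` (positive definite),
`Σ_{s=0}^{t−1} min(z̄_sᵀ V̄_s⁻¹ z̄_s, 1) ≤ 2 log(det(V̄_t)/det(λI))`. -/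
theorem stmt_5 {d : ℕ} (hd : 1 ≤ d) (lam : ℝ) (hlam : 0 < lam) {t : ℕ} (ht : 1 ≤ t)
    (z : ℕ → EuclideanSpace ℝ (Fin d))
    (V : ℕ → Matrix (Fin d) (Fin d) ℝ)
    (hV : ∀ s, V s = lam • (1 : Matrix (Fin d) (Fin d) ℝ) +
        ∑ k ∈ Finset.range s, vecMulVec (z k) (z k)) :
    (∀ s, (V s).PosDef) ∧
      ∑ s ∈ Finset.range t, min ((z s) ⬝ᵥ ((V s)⁻¹ *ᵥ (z s))) 1 ≤
        2 * Real.log ((V t).det / ((lam • (1 : Matrix (Fin d) (Fin d) ℝ)).det)) := by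
  have hpos : ∀ s, (V s).PosDef := fun s => by
    rw [hV]
    refine (PosDef.one.smul hlam).add_posSemidef (posSemidef_sum _ fun k _ => ?_)
    simpa using posSemidef_vecMulVec_self_star (z k : Fin d → ℝ)
  have hstep : ∀ s, (V (s + 1)).det = (V s).det * (1 + (z s) ⬝ᵥ ((V s)⁻¹ *ᵥ (z s))) := fun s => by
    rw [← det_add_vecMulVec (hpos s).det_pos.ne'.isUnit, hV (s + 1), Finset.sum_range_succ,
      ← add_assoc, ← hV]
  have hnonneg : ∀ s, 0 ≤ (z s) ⬝ᵥ ((V s)⁻¹ *ᵥ (z s)) := fun s => by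
    simpa using (hpos s).inv.posSemidef.dotProduct_mulVec_nonneg (z s : Fin d → ℝ)
  have hV0 : V 0 = lam • (1 : Matrix (Fin d) (Fin d) ℝ) := by simp [hV]
  refine ⟨hpos, ?_⟩
  rw [← hV0, Real.log_div (hpos t).det_pos.ne' (hpos 0).det_pos.ne',
    ← Finset.sum_range_sub (fun s => Real.log (V s).det), Finset.mul_sum]
  refine Finset.sum_le_sum fun s _ => ?_
  rw [hstep, Real.log_mul (hpos s).det_pos.ne' (by linarith [hnonneg s]), add_sub_cancel_left]
  exact Real.min_one_le_two_mul_log_one_add (hnonneg s)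
end

section
/- Let d, n ≥ 1 be natural numbers, λ > 0, T a natural number, c ≥ 0, and let zᵃ₀,…,zᵃ_T, ζ₀,…,ζ_T ∈ ℝ^d. Set z̄_s = zᵃ_s + ζ_s and V̄_s = λ·I + Σ_{k<s} z̄_k z̄_kᵀ. Let Θ⋆ and Θ̃₀,…,Θ̃_T be d×n real matrices, and assume that for every s ≤ T, ‖(Θ⋆ − Θ̃_s)ᵀ zᵃ_s‖² ≤ c · min( (zᵃ_s)ᵀ V̄_s⁻¹ zᵃ_s , 1 ). Then Σ_{s=0}^{T} ‖(Θ⋆ − Θ̃_s)ᵀ zᵃ_s‖² ≤ 2c · ( 2·log( det(V̄_{T+1}) / det(λI) ) + Σ_{s=0}^{T} min( ζ_sᵀ V̄_s⁻¹ ζ_s , 1/2 ) ). -/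
open Matrix

/-- The rank-one matrix determinant lemma, written with `vecMulVec`. -/
theorem det_add_vecMulVec_eq_det_mul {m : Type*} [Fintype m] [DecidableEq m]
    {A : Matrix m m ℝ} (hA : IsUnit A.det) (u v : m → ℝ) :
    (A + vecMulVec u v).det = A.det * (1 + v ⬝ᵥ (A⁻¹ *ᵥ u)) := by
  rw [vecMulVec_eq Unit, det_add_replicateCol_mul_replicateRow hA, Matrix.mul_assoc,
    ← replicateCol_mulVec, det_unique (n := Unit), Matrix.add_apply, one_apply_eq,
    replicateRow_mul_replicateCol_apply]

/-- A positive semidefinite quadratic form satisfies `q (a) ≤ 2 q (a + b) + 2 q (b)`. -/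
theorem Matrix.PosSemidef.dotProduct_mulVec_le_two_mul_add {m : Type*} [Fintype m]
    {M : Matrix m m ℝ} (hM : M.PosSemidef) (a b : m → ℝ) :
    a ⬝ᵥ (M *ᵥ a) ≤
      2 * ((a + b) ⬝ᵥ (M *ᵥ (a + b))) + 2 * (b ⬝ᵥ (M *ᵥ b)) := by
  have h := hM.dotProduct_mulVec_nonneg (a + b + b)
  simp only [star_trivial, mulVec_add, add_dotProduct, dotProduct_add] at h ⊢
  linarith

theorem min_one_le_two_mul_min_half_add {x y z : ℝ} (hy : 0 ≤ y) (hz : 0 ≤ z)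
    (h : x ≤ 2 * y + 2 * z) :
    min x 1 ≤ 2 * min y (1 / 2) + 2 * min z (1 / 2) := by
  rcases min_cases x 1 with h1 | h1 <;> rcases min_cases y (1 / 2) with h2 | h2 <;>
    rcases min_cases z (1 / 2) with h3 | h3 <;> linarith

/-- The elliptical potential lemma. -/
theorem sum_min_one_le_two_mul_log_det {m : Type*} [Fintype m] [DecidableEq m]
    {V : ℕ → Matrix m m ℝ} {z : ℕ → m → ℝ} (hpos : ∀ s, (V s).PosDef)
    (hsucc : ∀ s, V (s + 1) = V s + vecMulVec (z s) (z s)) (t : ℕ) :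
    ∑ s ∈ Finset.range t, min (z s ⬝ᵥ ((V s)⁻¹ *ᵥ z s)) 1 ≤
      2 * Real.log ((V t).det / (V 0).det) := by
  induction t with
  | zero => simp [(hpos 0).det_pos.ne']
  | succ t ih =>
    have hq : 0 ≤ z t ⬝ᵥ ((V t)⁻¹ *ᵥ z t) := by
      simpa using (hpos t).inv.posSemidef.dotProduct_mulVec_nonneg (z t)
    rw [Finset.sum_range_succ, hsucc,
      det_add_vecMulVec_eq_det_mul (hpos t).det_pos.ne'.isUnit, mul_div_right_comm,
      Real.log_mul (div_pos (hpos t).det_pos (hpos 0).det_pos).ne' (by positivity)]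
    linarith [Real.min_one_le_two_mul_log_one_add hq]

/-- Lemma 5 of the paper. With `z̄_s = zᵃ_s + ζ_s`,
`V̄_s = λI + Σ_{k<s} z̄_k z̄_kᵀ`, and the per-step bound
`‖(Θ⋆ − Θ̃_s)ᵀ zᵃ_s‖² ≤ c·min((zᵃ_s)ᵀ V̄_s⁻¹ zᵃ_s, 1)` for all `s ≤ T`, one has
`Σ_{s=0}^{T} ‖(Θ⋆ − Θ̃_s)ᵀ zᵃ_s‖² ≤
  2c (2 log(det(V̄_{T+1})/det(λI)) + Σ_{s=0}^{T} min(ζ_sᵀ V̄_s⁻¹ ζ_s, 1/2))`. -/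
theorem stmt_7 {d n : ℕ} (hd : 1 ≤ d) (hn : 1 ≤ n) (lam : ℝ) (hlam : 0 < lam)
    (T : ℕ) (c : ℝ) (hc : 0 ≤ c)
    (za ζ : ℕ → Fin d → ℝ)
    (zb : ℕ → Fin d → ℝ) (hzb : ∀ s, zb s = za s + ζ s)
    (V : ℕ → Matrix (Fin d) (Fin d) ℝ)
    (hV : ∀ s, V s = lam • (1 : Matrix (Fin d) (Fin d) ℝ) +
        ∑ k ∈ Finset.range s, vecMulVec (zb k) (zb k))
    (Θstar : Matrix (Fin d) (Fin n) ℝ) (Θtil : ℕ → Matrix (Fin d) (Fin n) ℝ)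
    (hstep : ∀ s ≤ T,
      ((Θstar - Θtil s)ᵀ *ᵥ za s) ⬝ᵥ ((Θstar - Θtil s)ᵀ *ᵥ za s) ≤
        c * min ((za s) ⬝ᵥ ((V s)⁻¹ *ᵥ (za s))) 1) :
    ∑ s ∈ Finset.range (T + 1),
        ((Θstar - Θtil s)ᵀ *ᵥ za s) ⬝ᵥ ((Θstar - Θtil s)ᵀ *ᵥ za s) ≤
      2 * c * (2 * Real.log ((V (T + 1)).det /
          ((lam • (1 : Matrix (Fin d) (Fin d) ℝ)).det)) +
        ∑ s ∈ Finset.range (T + 1), min ((ζ s) ⬝ᵥ ((V s)⁻¹ *ᵥ (ζ s))) (1 / 2)) := by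
  have hsucc : ∀ s, V (s + 1) = V s + vecMulVec (zb s) (zb s) := fun s => by
    rw [hV, hV, Finset.sum_range_succ, add_assoc]
  have hV0 : V 0 = lam • (1 : Matrix (Fin d) (Fin d) ℝ) := by simp [hV]
  have hpos : ∀ s, (V s).PosDef := fun s => by
    induction s with
    | zero => exact hV0 ▸ PosDef.one.smul hlam
    | succ s ih =>
      rw [hsucc]
      exact ih.add_posSemidef (by simpa using posSemidef_vecMulVec_self_star (zb s))
  have hq : ∀ s v, 0 ≤ v ⬝ᵥ ((V s)⁻¹ *ᵥ v) := fun s v => by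
    simpa using (hpos s).inv.posSemidef.dotProduct_mulVec_nonneg v
  have hterm : ∀ s ∈ Finset.range (T + 1),
      ((Θstar - Θtil s)ᵀ *ᵥ za s) ⬝ᵥ ((Θstar - Θtil s)ᵀ *ᵥ za s) ≤
        2 * c * (min (zb s ⬝ᵥ ((V s)⁻¹ *ᵥ zb s)) 1 +
          min (ζ s ⬝ᵥ ((V s)⁻¹ *ᵥ ζ s)) (1 / 2)) := fun s hs => by
    have hle := (hpos s).inv.posSemidef.dotProduct_mulVec_le_two_mul_add (za s) (ζ s)
    rw [← hzb] at hle
    have hmin := min_one_le_two_mul_min_half_add (hq s (zb s)) (hq s (ζ s)) hle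
    have hhalf : min (zb s ⬝ᵥ ((V s)⁻¹ *ᵥ zb s)) (1 / 2) ≤
        min (zb s ⬝ᵥ ((V s)⁻¹ *ᵥ zb s)) 1 := min_le_min_left _ (by norm_num)
    calc _ ≤ c * min (za s ⬝ᵥ ((V s)⁻¹ *ᵥ za s)) 1 :=
          hstep s (Nat.lt_succ_iff.mp (Finset.mem_range.mp hs))
      _ ≤ c * (2 * (min (zb s ⬝ᵥ ((V s)⁻¹ *ᵥ zb s)) 1 +
          min (ζ s ⬝ᵥ ((V s)⁻¹ *ᵥ ζ s)) (1 / 2))) :=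
          mul_le_mul_of_nonneg_left (by linarith) hc
      _ = _ := by ring
  refine (Finset.sum_le_sum hterm).trans ?_
  rw [← Finset.mul_sum, Finset.sum_add_distrib, ← hV0]
  have hpot := sum_min_one_le_two_mul_log_det hpos hsucc (T + 1)
  gcongr
end

section
/- Let p ≥ 1 be a natural number, λ > 0, T a natural number, X ≥ 0, C ≥ 0, Λ ≥ 0, and let zᵃ₀,…,zᵃ_{T−1}, ζ₀,…,ζ_{T−1} ∈ ℝ^p with ‖zᵃ_s‖² ≤ (1+C²)·X² and ‖ζ_s‖ ≤ Λ for all s < T. Set z̄_s = zᵃ_s + ζ_s and, for each t ≤ T, V_t = λ·I + Σ_{s<t} z̄_s z̄_sᵀ. Suppose 0 ≤ t₁ < t₂ < … < t_N ≤ T are times such that det(V_{t₁}) ≥ 2·λ^p and det(V_{t_{i+1}}) ≥ 2·det(V_{t_i}) for all 1 ≤ i < N. Then N ≤ p · log₂( 1 + (2T/λ)·( (1+C²)·X² + Λ² ) ). -/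
open Matrix

/-- By the AM-GM inequality on the eigenvalues, a positive semidefinite matrix of size `n` with
trace at most `n * a` has determinant at most `a ^ n`. -/
theorem Matrix.PosSemidef.det_le_pow_of_trace_le {n : Type*} [Fintype n] [DecidableEq n]
    {A : Matrix n n ℝ} (hA : A.PosSemidef) {a : ℝ} (ha : 0 < a)
    (htr : A.trace ≤ Fintype.card n * a) : A.det ≤ a ^ Fintype.card n := by
  have hdet : A.det = ∏ i, hA.isHermitian.eigenvalues i := by
    simpa using hA.isHermitian.det_eq_prod_eigenvalues
  have htrace : A.trace = ∑ i, hA.isHermitian.eigenvalues i := by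
    simpa using hA.isHermitian.trace_eq_sum_eigenvalues
  rw [hdet]
  rw [htrace] at htr
  calc ∏ i, hA.isHermitian.eigenvalues i
      ≤ ∏ i, a * Real.exp (hA.isHermitian.eigenvalues i / a - 1) := by
        refine Finset.prod_le_prod (fun i _ => hA.eigenvalues_nonneg i) fun i _ => ?_
        have h := Real.add_one_le_exp (hA.isHermitian.eigenvalues i / a - 1)
        rw [sub_add_cancel, div_le_iff₀ ha] at h
        linarith
    _ = a ^ Fintype.card n *
          Real.exp ((∑ i, hA.isHermitian.eigenvalues i) / a - Fintype.card n) := by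
        simp [Finset.prod_mul_distrib, ← Real.exp_sum, Finset.sum_div]
    _ ≤ a ^ Fintype.card n := by
        refine mul_le_of_le_one_right (by positivity) (Real.exp_le_one_iff.2 ?_)
        rw [sub_nonpos, div_le_iff₀ ha]
        exact htr

theorem norm_add_sq_le_two_mul {E : Type*} [SeminormedAddCommGroup E] (x y : E) :
    ‖x + y‖ ^ 2 ≤ 2 * (‖x‖ ^ 2 + ‖y‖ ^ 2) :=
  (pow_le_pow_left₀ (norm_nonneg _) (norm_add_le x y) 2).trans add_sq_le

/-- The determinant of a regularized Gram matrix `lam • 1 + ∑ z zᵀ`, in terms of a bound on the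
vectors `z`. -/
theorem det_smul_one_add_sum_vecMulVec_le {p t : ℕ} (hp : 1 ≤ p) {lam B : ℝ} (hlam : 0 < lam)
    (hB : 0 ≤ B) (z : ℕ → EuclideanSpace ℝ (Fin p)) (hz : ∀ s < t, ‖z s‖ ^ 2 ≤ B) :
    (lam • (1 : Matrix (Fin p) (Fin p) ℝ) +
      ∑ s ∈ Finset.range t, vecMulVec (z s) (z s)).det ≤ (lam + t * B) ^ p := by
  have hpos : (lam • (1 : Matrix (Fin p) (Fin p) ℝ) +
      ∑ s ∈ Finset.range t, vecMulVec (z s) (z s)).PosSemidef := by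
    refine (PosSemidef.one.smul hlam.le).add (posSemidef_sum _ fun s _ => ?_)
    simpa using posSemidef_vecMulVec_self_star (z s : Fin p → ℝ)
  have htr : (∑ s ∈ Finset.range t, vecMulVec (z s) (z s)).trace ≤ t * B := by
    rw [trace_sum]
    refine (Finset.sum_le_card_nsmul _ _ B fun s hs => ?_).trans (by simp)
    rw [trace_vecMulVec]
    refine le_of_eq_of_le ?_ (hz s (Finset.mem_range.1 hs))
    simp [EuclideanSpace.real_norm_sq_eq, dotProduct, ← sq]
  have hp' : (1 : ℝ) ≤ p := by exact_mod_cast hp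
  have htB : 0 ≤ t * B := by positivity
  simpa using hpos.det_le_pow_of_trace_le (a := lam + t * B) (by positivity) (by
    simp only [trace_add, trace_smul, trace_one, Fintype.card_fin, smul_eq_mul]
    nlinarith)

/-- A sequence that at least doubles at each step grows geometrically. -/
theorem two_pow_mul_le_of_doubling {N : ℕ} {d : ℕ → ℝ}
    (hd : ∀ i < N, 2 * d i ≤ d (i + 1)) : 2 ^ N * d 0 ≤ d N := by
  induction N with
  | zero => simp
  | succ n ih =>
    have h := ih fun i hi => hd i (by omega)
    have := hd n (by omega)
    rw [pow_succ]
    linarith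

/-- Bound on the number of policy switches: with
`z̄_s = zᵃ_s + ζ_s`, `‖zᵃ_s‖² ≤ (1+C²)X²`, `‖ζ_s‖ ≤ Λ`,
`V_t = λI + Σ_{s<t} z̄_s z̄_sᵀ`, and times `0 ≤ t₁ < ⋯ < t_N ≤ T` with
`det(V_{t₁}) ≥ 2λ^p` and `det(V_{t_{i+1}}) ≥ 2 det(V_{t_i})`, one has
`N ≤ p·log₂(1 + (2T/λ)((1+C²)X² + Λ²))`. -/
theorem stmt_9 {p : ℕ} (hp : 1 ≤ p) (lam : ℝ) (hlam : 0 < lam) (T : ℕ)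
    (X C Λ : ℝ) (hX : 0 ≤ X) (hC : 0 ≤ C) (hΛ : 0 ≤ Λ)
    (za ζ : ℕ → EuclideanSpace ℝ (Fin p))
    (hza : ∀ s < T, ‖za s‖ ^ 2 ≤ (1 + C ^ 2) * X ^ 2)
    (hζ : ∀ s < T, ‖ζ s‖ ≤ Λ)
    (V : ℕ → Matrix (Fin p) (Fin p) ℝ)
    (hV : ∀ t, V t = lam • (1 : Matrix (Fin p) (Fin p) ℝ) +
        ∑ s ∈ Finset.range t, vecMulVec (za s + ζ s) (za s + ζ s))
    (N : ℕ) (tt : ℕ → ℕ)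
    (htmono : ∀ i, 1 ≤ i → i < N → tt i < tt (i + 1))
    (htT : ∀ i, 1 ≤ i → i ≤ N → tt i ≤ T)
    (hdet1 : 1 ≤ N → 2 * lam ^ p ≤ (V (tt 1)).det)
    (hdet : ∀ i, 1 ≤ i → i < N → 2 * (V (tt i)).det ≤ (V (tt (i + 1))).det) :
    (N : ℝ) ≤ (p : ℝ) *
      Real.logb 2 (1 + (2 * (T : ℝ) / lam) * ((1 + C ^ 2) * X ^ 2 + Λ ^ 2)) := by
  set B := 2 * ((1 + C ^ 2) * X ^ 2 + Λ ^ 2) with hBdef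
  have hB : 0 ≤ B := by positivity
  have hz : ∀ s < T, ‖za s + ζ s‖ ^ 2 ≤ B := fun s hs => by
    have h1 := norm_add_sq_le_two_mul (za s) (ζ s)
    have h2 := hza s hs
    have h3 := pow_le_pow_left₀ (norm_nonneg _) (hζ s hs) 2
    linarith
  have hratio : 1 + (2 * (T : ℝ) / lam) * ((1 + C ^ 2) * X ^ 2 + Λ ^ 2) =
      (lam + T * B) / lam := by
    rw [hBdef]
    field_simp
  have hgrowth : 2 ^ N * lam ^ p ≤ (lam + T * B) ^ p := by
    rcases Nat.eq_zero_or_pos N with rfl | hN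
    · rw [pow_zero, one_mul]
      gcongr
      exact le_add_of_nonneg_right (by positivity)
    · have hdouble := two_pow_mul_le_of_doubling (N := N)
        (d := fun i => if i = 0 then lam ^ p else (V (tt i)).det) fun i hi => by
          rcases Nat.eq_zero_or_pos i with rfl | hi0
          · simpa using hdet1 hN
          · simpa [hi0.ne'] using hdet i hi0 hi
      have htN := htT N hN le_rfl
      have hup := det_smul_one_add_sum_vecMulVec_le hp hlam hB (fun s => za s + ζ s)
        fun s (hs : s < tt N) => hz s (hs.trans_le htN)
      simp only [if_true, hN.ne', if_false, hV] at hdouble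
      refine (hdouble.trans hup).trans ?_
      gcongr
  rw [hratio, ← Real.logb_pow, Real.le_logb_iff_rpow_le one_lt_two (by positivity),
    Real.rpow_natCast, div_pow, le_div_iff₀ (by positivity)]
  exact hgrowth
end

section
/- Let n, p be natural numbers, t ≥ 1, and let ρ, η be reals with 0 < ρ < 1 and ρ ≤ η. Let Γ₀,…,Γ_{t−1} be real n×n matrices and r₁,…,r_t ∈ ℝ^n, and define x₀ = 0 and x_{s+1} = Γ_s x_s + r_{s+1} for 0 ≤ s < t. Assume that for every k ≤ t, ∏_{s=k}^{t−1} ‖Γ_s‖ ≤ η^p · ρ^{(t−k)−p} (operator norms, integer powers). Then ‖x_t‖ ≤ (1/(1−ρ)) · (η/ρ)^p · max_{1 ≤ k ≤ t} ‖r_k‖. -/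
open Matrix

/-- A solution of an inhomogeneous linear recursion started at `0` is bounded by the sum of the
inhomogeneities, each weighted by the product of the norms of the operators applied after it. -/
theorem norm_le_sum_prod_norm_of_linear_recursion {E : Type*} [SeminormedAddCommGroup E]
    [NormedSpace ℝ E] (A : ℕ → E →L[ℝ] E) (r x : ℕ → E) (hx0 : x 0 = 0) (m : ℕ)
    (hrec : ∀ s < m, x (s + 1) = A s (x s) + r (s + 1)) :
    ‖x m‖ ≤ ∑ k ∈ Finset.range m, (∏ s ∈ Finset.Ico (k + 1) m, ‖A s‖) * ‖r (k + 1)‖ := by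
  induction m with
  | zero => simp [hx0]
  | succ m ih =>
    have hstep : ∑ k ∈ Finset.range m, (∏ s ∈ Finset.Ico (k + 1) (m + 1), ‖A s‖) * ‖r (k + 1)‖ =
        ‖A m‖ * ∑ k ∈ Finset.range m, (∏ s ∈ Finset.Ico (k + 1) m, ‖A s‖) * ‖r (k + 1)‖ := by
      rw [Finset.mul_sum]
      refine Finset.sum_congr rfl fun k hk => ?_
      rw [Finset.prod_Ico_succ_top (Finset.mem_range.mp hk)]
      ring
    rw [hrec m m.lt_succ_self, Finset.sum_range_succ, hstep, Finset.Ico_self,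
      Finset.prod_empty, one_mul]
    refine (norm_add_le _ _).trans ?_
    gcongr
    refine ((A m).le_opNorm _).trans ?_
    gcongr
    exact ih fun s hs => hrec s (hs.trans m.lt_succ_self)

/-- A partial sum of a geometric series with ratio in `[0, 1)` is at most its total. -/
theorem geom_sum_le_one_div_one_sub {ρ : ℝ} (hρ0 : 0 ≤ ρ) (hρ1 : ρ < 1) (t : ℕ) :
    ∑ k ∈ Finset.range t, ρ ^ k ≤ 1 / (1 - ρ) := by
  rw [one_div, ← tsum_geometric_of_lt_one hρ0 hρ1]
  exact (summable_geometric_of_lt_one hρ0 hρ1).sum_le_tsum _ fun k _ => pow_nonneg hρ0 k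

/-- State bound for the attacked closed loop: with `x₀ = 0`,
`x_{s+1} = Γ_s x_s + r_{s+1}`, and the product bound
`∏_{s=k}^{t−1} ‖Γ_s‖ ≤ η^p ρ^{(t−k)−p}` for every `k ≤ t`, one has
`‖x_t‖ ≤ (1/(1−ρ)) (η/ρ)^p max_{1 ≤ k ≤ t} ‖r_k‖`. -/
theorem stmt_13 {n : ℕ} (p : ℕ) {t : ℕ} (ht : 1 ≤ t)
    (ρ η : ℝ) (hρ0 : 0 < ρ) (hρ1 : ρ < 1) (hρη : ρ ≤ η)
    (Γ : ℕ → Matrix (Fin n) (Fin n) ℝ)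
    (r : ℕ → EuclideanSpace ℝ (Fin n))
    (x : ℕ → EuclideanSpace ℝ (Fin n)) (hx0 : x 0 = 0)
    (hrec : ∀ s < t, x (s + 1) = Matrix.toEuclideanCLM (𝕜 := ℝ) (Γ s) (x s) + r (s + 1))
    (hΓ : ∀ k ≤ t, ∏ s ∈ Finset.Ico k t, ‖Matrix.toEuclideanCLM (𝕜 := ℝ) (Γ s)‖ ≤
      η ^ p * ρ ^ ((t : ℤ) - (k : ℤ) - (p : ℤ))) :
    ‖x t‖ ≤ (1 / (1 - ρ)) * (η / ρ) ^ p *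
      (Finset.Icc 1 t).sup' (Finset.nonempty_Icc.mpr ht) (fun k => ‖r k‖) := by
  set M := (Finset.Icc 1 t).sup' (Finset.nonempty_Icc.mpr ht) (fun k => ‖r k‖)
  have hr : ∀ k < t, ‖r (k + 1)‖ ≤ M := fun k hk =>
    Finset.le_sup' (fun k => ‖r k‖) (Finset.mem_Icc.mpr ⟨by omega, hk⟩)
  have hM0 : 0 ≤ M := (norm_nonneg _).trans (hr 0 ht)
  have hη0 : 0 ≤ η := hρ0.le.trans hρη
  have hprod : ∀ k < t, ∏ s ∈ Finset.Ico (k + 1) t, ‖Matrix.toEuclideanCLM (𝕜 := ℝ) (Γ s)‖ ≤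
      (η / ρ) ^ p * ρ ^ (t - 1 - k) := by
    intro k hk
    refine (hΓ (k + 1) hk).trans_eq ?_
    have he : (t : ℤ) - ((k + 1 : ℕ) : ℤ) = ((t - 1 - k : ℕ) : ℤ) := by omega
    rw [he, zpow_sub₀ hρ0.ne', zpow_natCast, zpow_natCast, div_pow]
    ring
  calc ‖x t‖ ≤ ∑ k ∈ Finset.range t,
        (∏ s ∈ Finset.Ico (k + 1) t, ‖Matrix.toEuclideanCLM (𝕜 := ℝ) (Γ s)‖) * ‖r (k + 1)‖ :=
        norm_le_sum_prod_norm_of_linear_recursion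
          (fun s => Matrix.toEuclideanCLM (𝕜 := ℝ) (Γ s)) r x hx0 t hrec
    _ ≤ ∑ k ∈ Finset.range t, (η / ρ) ^ p * ρ ^ (t - 1 - k) * M := by
        refine Finset.sum_le_sum fun k hk => ?_
        have hk := Finset.mem_range.mp hk
        exact mul_le_mul (hprod k hk) (hr k hk) (norm_nonneg _) (by positivity)
    _ = (∑ k ∈ Finset.range t, ρ ^ k) * (η / ρ) ^ p * M := by
        rw [← Finset.sum_mul, ← Finset.mul_sum, Finset.sum_range_reflect (fun k => ρ ^ k) t]
        ring
    _ ≤ 1 / (1 - ρ) * (η / ρ) ^ p * M := by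
        gcongr
        exact geom_sum_le_one_div_one_sub hρ0.le hρ1 t
end

section
/- Let d, n ≥ 1 and T be natural numbers, D ≥ 0, S ≥ 0, Z ≥ 0, K ≥ 0. Let P₀,…,P_T be real symmetric positive semidefinite n×n matrices with operator norm ‖P_t‖ ≤ D; let z₀,…,z_T ∈ ℝ^d with ‖z_t‖ ≤ Z; let Θ⋆ and Θ̃₀,…,Θ̃_T be d×n real matrices with Frobenius norms ‖Θ⋆‖_F ≤ S and ‖Θ̃_t‖_F ≤ S; and assume Σ_{t=0}^{T} ‖(Θ̃_t − Θ⋆)ᵀ z_t‖² ≤ K. Then | Σ_{t=0}^{T} ( (Θ̃_tᵀ z_t)ᵀ P_t (Θ̃_tᵀ z_t) − (Θ⋆ᵀ z_t)ᵀ P_t (Θ⋆ᵀ z_t) ) | ≤ 2·D·S·Z·√( (T+1)·K ). -/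
open Matrix

open scoped RealInnerProductSpace in
/-- The difference of two values of a symmetric quadratic form is controlled by the operator norm. -/
theorem ContinuousLinearMap.abs_inner_map_self_sub_le {E : Type*} [NormedAddCommGroup E]
    [InnerProductSpace ℝ E] {L : E →L[ℝ] E} (hL : (L : E →ₗ[ℝ] E).IsSymmetric) (a b : E) :
    |⟪a, L a⟫ - ⟪b, L b⟫| ≤ ‖L‖ * ‖a + b‖ * ‖a - b‖ := by
  have hab : ⟪a, L b⟫ = ⟪b, L a⟫ := by
    rw [real_inner_comm]
    exact hL b a
  have key : ⟪a, L a⟫ - ⟪b, L b⟫ = ⟪a + b, L (a - b)⟫ := by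
    simp only [map_sub, inner_sub_right, inner_add_left]
    linarith
  rw [key]
  calc |⟪a + b, L (a - b)⟫| ≤ ‖a + b‖ * ‖L (a - b)‖ := abs_real_inner_le_norm _ _
    _ ≤ ‖a + b‖ * (‖L‖ * ‖a - b‖) := by gcongr; exact L.le_opNorm _
    _ = ‖L‖ * ‖a + b‖ * ‖a - b‖ := by ring

theorem norm_toLp_transpose_mulVec_le {a b : ℕ} (A : Matrix (Fin a) (Fin b) ℝ)
    (x : EuclideanSpace ℝ (Fin a)) :
    ‖WithLp.toLp 2 (Aᵀ *ᵥ x)‖ ≤ frobNorm A * ‖x‖ := by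
  rw [EuclideanSpace.norm_eq, EuclideanSpace.norm_eq, frobNorm, ← Real.sqrt_mul']
  · apply Real.sqrt_le_sqrt
    simp only [Real.norm_eq_abs, sq_abs, Matrix.trace, Matrix.diag_apply, Matrix.mul_apply,
      Matrix.transpose_apply, Matrix.mulVec, dotProduct,
      Finset.sum_mul (s := Finset.univ (α := Fin b)), ← sq]
    exact Finset.sum_le_sum fun j _ => Finset.sum_mul_sq_le_sq_mul_sq _ _ _
  · positivity

theorem Finset.sum_le_sqrt_card_mul {ι : Type*} (s : Finset ι) (f : ι → ℝ) {K : ℝ}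
    (h : ∑ i ∈ s, f i ^ 2 ≤ K) : ∑ i ∈ s, f i ≤ √(s.card * K) := by
  apply Real.le_sqrt_of_sq_le
  exact sq_sum_le_card_mul_sum_sq.trans (by gcongr)

/-- Deterministic Cauchy–Schwarz core of the bound on the regret
term `R₃`: with symmetric psd matrices `P_t` of operator norm `≤ D`, `‖z_t‖ ≤ Z`,
`‖Θ⋆‖_F ≤ S`, `‖Θ̃_t‖_F ≤ S`, and `Σ_t ‖(Θ̃_t − Θ⋆)ᵀ z_t‖² ≤ K`,
`|Σ_{t=0}^{T} ((Θ̃_tᵀz_t)ᵀ P_t (Θ̃_tᵀz_t) − (Θ⋆ᵀz_t)ᵀ P_t (Θ⋆ᵀz_t))| ≤ 2DSZ√((T+1)K)`. -/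
theorem stmt_14 {d n : ℕ} (hd : 1 ≤ d) (hn : 1 ≤ n) (T : ℕ)
    (D S Z K : ℝ) (hD : 0 ≤ D) (hS : 0 ≤ S) (hZ : 0 ≤ Z) (hK : 0 ≤ K)
    (P : ℕ → Matrix (Fin n) (Fin n) ℝ)
    (hPsd : ∀ t ≤ T, (P t).PosSemidef)
    (hPnorm : ∀ t ≤ T, ‖Matrix.toEuclideanCLM (𝕜 := ℝ) (P t)‖ ≤ D)
    (z : ℕ → EuclideanSpace ℝ (Fin d)) (hz : ∀ t ≤ T, ‖z t‖ ≤ Z)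
    (Θstar : Matrix (Fin d) (Fin n) ℝ) (Θtil : ℕ → Matrix (Fin d) (Fin n) ℝ)
    (hΘstar : frobNorm Θstar ≤ S)
    (hΘtil : ∀ t ≤ T, frobNorm (Θtil t) ≤ S)
    (hKsum : ∑ t ∈ Finset.range (T + 1),
        ((Θtil t - Θstar)ᵀ *ᵥ (z t)) ⬝ᵥ ((Θtil t - Θstar)ᵀ *ᵥ (z t)) ≤ K) :
    |∑ t ∈ Finset.range (T + 1),
        (((Θtil t)ᵀ *ᵥ (z t)) ⬝ᵥ ((P t) *ᵥ ((Θtil t)ᵀ *ᵥ (z t))) -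
          (Θstarᵀ *ᵥ (z t)) ⬝ᵥ ((P t) *ᵥ (Θstarᵀ *ᵥ (z t))))| ≤
      2 * D * S * Z * Real.sqrt (((T : ℝ) + 1) * K) := by
  let a : ℕ → EuclideanSpace ℝ (Fin n) := fun t => WithLp.toLp 2 ((Θtil t)ᵀ *ᵥ (z t))
  let b : ℕ → EuclideanSpace ℝ (Fin n) := fun t => WithLp.toLp 2 (Θstarᵀ *ᵥ (z t))
  have hsub (t : ℕ) : ((Θtil t - Θstar)ᵀ *ᵥ (z t)) ⬝ᵥ ((Θtil t - Θstar)ᵀ *ᵥ (z t)) =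
      ‖a t - b t‖ ^ 2 := by
    rw [Matrix.transpose_sub, Matrix.sub_mulVec, EuclideanSpace.real_norm_sq_eq]
    simp [a, b, dotProduct, sq]
  have hbound {A : Matrix (Fin d) (Fin n) ℝ} (hA : frobNorm A ≤ S) {t : ℕ} (ht : t ≤ T) :
      ‖WithLp.toLp 2 (Aᵀ *ᵥ (z t))‖ ≤ S * Z :=
    (norm_toLp_transpose_mulVec_le A (z t)).trans
      (mul_le_mul hA (hz t ht) (norm_nonneg _) hS)
  have hterm (t : ℕ) (ht : t ≤ T) :
      |((Θtil t)ᵀ *ᵥ (z t)) ⬝ᵥ ((P t) *ᵥ ((Θtil t)ᵀ *ᵥ (z t))) -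
        (Θstarᵀ *ᵥ (z t)) ⬝ᵥ ((P t) *ᵥ (Θstarᵀ *ᵥ (z t)))| ≤
      2 * D * S * Z * ‖a t - b t‖ := by
    have hsymm := Matrix.isSymmetric_toEuclideanLin_iff.mpr (hPsd t ht).isHermitian
    rw [← Matrix.coe_toEuclideanCLM_eq_toEuclideanLin] at hsymm
    have h := ContinuousLinearMap.abs_inner_map_self_sub_le hsymm (a t) (b t)
    rw [Matrix.inner_toEuclideanCLM, Matrix.inner_toEuclideanCLM] at h
    have hadd : ‖a t + b t‖ ≤ 2 * (S * Z) := by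
      linarith [norm_add_le (a t) (b t), hbound (hΘtil t ht) ht, hbound hΘstar ht]
    calc _ ≤ _ := h
      _ ≤ D * (2 * (S * Z)) * ‖a t - b t‖ := by
        gcongr
        exact hPnorm t ht
      _ = 2 * D * S * Z * ‖a t - b t‖ := by ring
  have hsum : ∑ t ∈ Finset.range (T + 1), ‖a t - b t‖ ≤ √(((T : ℝ) + 1) * K) := by
    simp only [hsub] at hKsum
    simpa using Finset.sum_le_sqrt_card_mul _ _ hKsum
  calc _ ≤ _ := Finset.abs_sum_le_sum_abs _ _
    _ ≤ ∑ t ∈ Finset.range (T + 1), 2 * D * S * Z * ‖a t - b t‖ :=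
      Finset.sum_le_sum fun t ht => hterm t (Finset.mem_range_succ_iff.mp ht)
    _ = 2 * D * S * Z * ∑ t ∈ Finset.range (T + 1), ‖a t - b t‖ := by rw [Finset.mul_sum]
    _ ≤ _ := by gcongr
end
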